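/- Let n ≥ 2 be an integer and let F(x;y) ∈ ℤ[x₁,…,xₙ,y₁,…,yₙ] be a bihomogeneous form of bidegree (2,2) such that the hypersurface X = {F = 0} ⊂ ℙ^{n−1} × ℙ^{n−1} is smooth. Then the polynomial x ↦ det(F_x) = det M(x) is not identically zero; that is, there exists x ∈ ℚⁿ with det(F_x) ≠ 0. -/

import Mathlib

open scoped BigOperators
open MeasureTheory Filter

noncomputable section

def ee (t : ℝ) : ℂ := Complex.exp (2 * Real.pi * Complex.I * t)

def supNorm {n : ℕ} (x : Fin n → ℤ) : ℕ := Finset.univ.sup fun i => (x i).natAbs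

def box (n : ℕ) (κ : ℝ) : Set (Fin n → ℝ) := Set.univ.pi fun _ => Set.Icc (-κ) κ

/-- the bihomogeneous form `F(x;y) = ∑ A_{ijkl} x_i x_j y_k y_l` over `ℤ` -/
def biForm {n : ℕ} (A : Fin n → Fin n → Fin n → Fin n → ℤ) (x y : Fin n → ℤ) : ℤ :=
  ∑ i, ∑ j, ∑ k, ∑ l, A i j k l * x i * x j * y k * y l

/-- the bihomogeneous form over `ℝ` -/
def biFormR {n : ℕ} (A : Fin n → Fin n → Fin n → Fin n → ℤ) (x y : Fin n → ℝ) : ℝ :=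
  ∑ i, ∑ j, ∑ k, ∑ l, (A i j k l : ℝ) * x i * x j * y k * y l

/-- the symmetric matrix `M(x)` of the quadratic form `F_x`, over `ℚ` -/
def matFx {n : ℕ} (A : Fin n → Fin n → Fin n → Fin n → ℤ) (x : Fin n → ℚ) :
    Matrix (Fin n) (Fin n) ℚ :=
  Matrix.of fun k l => (∑ i, ∑ j, ((A i j k l + A i j l k : ℤ) : ℚ) * x i * x j) / 2

/-- the symmetric matrix of the quadratic form `F_y`, over `ℚ` -/
def matFy {n : ℕ} (A : Fin n → Fin n → Fin n → Fin n → ℤ) (y : Fin n → ℚ) :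
    Matrix (Fin n) (Fin n) ℚ :=
  Matrix.of fun i j => (∑ k, ∑ l, ((A i j k l + A j i k l : ℤ) : ℚ) * y k * y l) / 2

/-- `det(F_x)` for an integer vector `x` -/
def detFx {n : ℕ} (A : Fin n → Fin n → Fin n → Fin n → ℤ) (x : Fin n → ℤ) : ℚ :=
  (matFx A fun i => (x i : ℚ)).det

/-- `det(F_y)` for an integer vector `y` -/
def detFy {n : ℕ} (A : Fin n → Fin n → Fin n → Fin n → ℤ) (y : Fin n → ℤ) : ℚ :=
  (matFy A fun i => (y i : ℚ)).det

/-- smoothness of the biprojective hypersurface `{F = 0}`: no point with `x ≠ 0`, `y ≠ 0`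
where all `2n` partial derivatives of `F` vanish. -/
def SmoothBiquad {n : ℕ} (A : Fin n → Fin n → Fin n → Fin n → ℤ) : Prop :=
  ∀ x y : Fin n → ℂ, x ≠ 0 → y ≠ 0 →
    ¬ ((∀ m, ∑ j, ∑ k, ∑ l, ((A m j k l + A j m k l : ℤ) : ℂ) * x j * y k * y l = 0) ∧
       (∀ m, ∑ i, ∑ j, ∑ l, ((A i j m l + A i j l m : ℤ) : ℂ) * x i * x j * y l = 0))

/-- the complete exponential sum attached to `F(x;y)` -/
def biExpSum {n : ℕ} (A : Fin n → Fin n → Fin n → Fin n → ℤ) (q : ℕ) : ℂ :=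
  ∑ a ∈ (Finset.range q).filter fun a => Nat.Coprime a q,
    ∑ x : Fin n → Fin q, ∑ y : Fin n → Fin q,
      ee ((((a : ℤ) * biForm A (fun i => ((x i : ℕ) : ℤ)) (fun i => ((y i : ℕ) : ℤ)) : ℤ) : ℝ) / q)

/-- the singular series `𝔖` of `F(x;y)` -/
def biSingSeries {n : ℕ} (A : Fin n → Fin n → Fin n → Fin n → ℤ) : ℂ :=
  ∑' q : ℕ+, ((q : ℕ) : ℂ) ^ (-(2 * (n : ℤ))) * biExpSum A q

/-- the singular integral `ℑ` of `F(x;y)` -/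
def biSingInt {n : ℕ} (A : Fin n → Fin n → Fin n → Fin n → ℤ) : ℂ :=
  ∫ θ : ℝ, ∫ p in (box n 1) ×ˢ (box n 1), ee (-(θ * biFormR A p.1 p.2))

def expSumGen {n : ℕ} (G : (Fin n → ℤ) → ℤ) (c : Fin n → ℤ) (q : ℕ) : ℂ :=
  ∑ a ∈ (Finset.range q).filter fun a => Nat.Coprime a q,
    ∑ b : Fin n → Fin q,
      ee ((((a : ℤ) * G (fun i => ((b i : ℕ) : ℤ)) + ∑ i, ((b i : ℕ) : ℤ) * c i : ℤ) : ℝ) / q)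

def singSeriesGen {n : ℕ} (G : (Fin n → ℤ) → ℤ) : ℂ :=
  ∑' q : ℕ+, ((q : ℕ) : ℂ) ^ (-(n : ℤ)) * expSumGen G 0 q

/-- the singular integral `σ_∞(w₀;F_x)` of the quadratic form `F_x` -/
def sigFx {n : ℕ} (A : Fin n → Fin n → Fin n → Fin n → ℤ) (x : Fin n → ℤ) : ℂ :=
  ∫ θ : ℝ, ∫ y in box n 1, ee (-(θ * biFormR A (fun i => (x i : ℝ)) y))

/-- the singular series `𝔖(F_x)` of the quadratic form `F_x` -/
def serFx {n : ℕ} (A : Fin n → Fin n → Fin n → Fin n → ℤ) (x : Fin n → ℤ) : ℂ :=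
  singSeriesGen (fun y => biForm A x y)

/-- `S(X) = ∑_{x ∈ 𝒜₁, |x| ≤ X} σ_∞(w₀;F_x)𝔖(F_x)` -/
def SFx {n : ℕ} (A : Fin n → Fin n → Fin n → Fin n → ℤ) (X : ℝ) : ℂ :=
  ∑' x : Fin n → ℤ,
    if detFx A x ≠ 0 ∧ (supNorm x : ℝ) ≤ X then sigFx A x * serFx A x else 0

/-- `N(𝒜;X,Y)` -/
def NcalA {n : ℕ} (A : Fin n → Fin n → Fin n → Fin n → ℤ) (X Y : ℝ) : ℕ :=
  Nat.card {p : (Fin n → ℤ) × (Fin n → ℤ) //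
    detFx A p.1 ≠ 0 ∧ detFy A p.2 ≠ 0 ∧ (supNorm p.1 : ℝ) ≤ X ∧ (supNorm p.2 : ℝ) ≤ Y ∧
    biForm A p.1 p.2 = 0}

/-- `Ñ(X,Y)` -/
def Ntilde {n : ℕ} (A : Fin n → Fin n → Fin n → Fin n → ℤ) (X Y : ℝ) : ℕ :=
  Nat.card {p : (Fin n → ℤ) × (Fin n → ℤ) //
    detFx A p.1 ≠ 0 ∧ (supNorm p.1 : ℝ) ≤ X ∧ (supNorm p.2 : ℝ) ≤ Y ∧ biForm A p.1 p.2 = 0}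

/-- `N_U(B)`, counting rational points of height at most `B` on the open subset `U` -/
def NU {n : ℕ} (A : Fin n → Fin n → Fin n → Fin n → ℤ) (B : ℝ) : ℝ :=
  (Nat.card {p : (Fin n → ℤ) × (Fin n → ℤ) //
    Finset.univ.gcd p.1 = 1 ∧ Finset.univ.gcd p.2 = 1 ∧
    detFx A p.1 ≠ 0 ∧ detFy A p.2 ≠ 0 ∧ biForm A p.1 p.2 = 0 ∧
    (supNorm p.1 : ℝ) ^ (n - 2) * (supNorm p.2 : ℝ) ^ (n - 2) ≤ B} : ℝ) / 4

def kap (n : ℕ) : ℝ := if Even n then 0 else 1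


/-- If `M` is symmetric and `M v = 0`, then `vᵀ (∂M) v = 0` for every derivation `∂`. -/
theorem sum_mul_derivation_mul_eq_zero {R P ι : Type*} [CommRing R] [CommRing P] [Algebra R P]
    [Fintype ι] (D : Derivation R P P) (M : Matrix ι ι P) (hM : ∀ k l, M k l = M l k)
    (v : ι → P) (hv : ∀ k, ∑ l, M k l * v l = 0) :
    ∑ k, ∑ l, D (M k l) * v k * v l = 0 := by
  have h : ∀ k, ∑ l, (M k l * D (v l) + v l * D (M k l)) = 0 := fun k => by
    simpa using congrArg D (hv k)
  have h1 : ∑ k, v k * ∑ l, (M k l * D (v l) + v l * D (M k l)) = 0 := by simp [h]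
  have h2 : ∑ k, ∑ l, v k * (M k l * D (v l)) = 0 := by
    rw [Finset.sum_comm]
    refine Finset.sum_eq_zero fun l _ => ?_
    calc ∑ k, v k * (M k l * D (v l)) = (∑ k, M l k * v k) * D (v l) := by
          rw [Finset.sum_mul]
          exact Finset.sum_congr rfl fun k _ => by rw [hM k l]; ring
      _ = 0 := by rw [hv l, zero_mul]
  simp only [Finset.mul_sum, mul_add, Finset.sum_add_distrib, h2, zero_add] at h1
  rw [← h1]
  exact Finset.sum_congr rfl fun k _ => Finset.sum_congr rfl fun l _ => by ring

/-- The Hessian of `F` in `y`, with entries quadratic polynomials in `x`. -/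
def polyHessian {n : ℕ} (A : Fin n → Fin n → Fin n → Fin n → ℤ) :
    Matrix (Fin n) (Fin n) (MvPolynomial (Fin n) ℚ) :=
  Matrix.of fun k l => ∑ i, ∑ j,
    MvPolynomial.C ((A i j k l + A i j l k : ℤ) : ℚ) * MvPolynomial.X i * MvPolynomial.X j

theorem polyHessian_symm {n : ℕ} (A : Fin n → Fin n → Fin n → Fin n → ℤ) (k l : Fin n) :
    polyHessian A k l = polyHessian A l k := by
  simp only [polyHessian, Matrix.of_apply]
  refine Finset.sum_congr rfl fun i _ => Finset.sum_congr rfl fun j _ => ?_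
  rw [add_comm (A i j k l)]

theorem eval_polyHessian {n : ℕ} (A : Fin n → Fin n → Fin n → Fin n → ℤ) (x : Fin n → ℚ)
    (k l : Fin n) : MvPolynomial.eval x (polyHessian A k l) =
      ∑ i, ∑ j, ((A i j k l + A i j l k : ℤ) : ℚ) * x i * x j := by
  simp [polyHessian]

theorem map_eval_polyHessian {n : ℕ} (A : Fin n → Fin n → Fin n → Fin n → ℤ) (x : Fin n → ℚ) :
    (polyHessian A).map (MvPolynomial.eval x) = (2 : ℚ) • matFx A x := by
  ext k l
  rw [Matrix.map_apply, eval_polyHessian, Matrix.smul_apply, matFx, Matrix.of_apply, smul_eq_mul,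
    mul_div_cancel₀ _ two_ne_zero]

theorem eval_pderiv_polyHessian {n : ℕ} (A : Fin n → Fin n → Fin n → Fin n → ℤ) (x : Fin n → ℚ)
    (m k l : Fin n) : MvPolynomial.eval x (MvPolynomial.pderiv m (polyHessian A k l)) =
      ∑ j, ((A m j k l + A m j l k + A j m k l + A j m l k : ℤ) : ℚ) * x j := by
  have h : ∀ i j, MvPolynomial.eval x (MvPolynomial.pderiv m
      (MvPolynomial.C ((A i j k l + A i j l k : ℤ) : ℚ) * MvPolynomial.X i * MvPolynomial.X j)) =
      (if i = m then ((A i j k l + A i j l k : ℤ) : ℚ) * x j else 0) +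
      (if j = m then ((A i j k l + A i j l k : ℤ) : ℚ) * x i else 0) := fun i j => by
    simp only [Derivation.leibniz, MvPolynomial.pderiv_C, MvPolynomial.pderiv_X, Pi.single_apply,
      smul_eq_mul, map_add, map_mul, MvPolynomial.eval_X, MvPolynomial.eval_C, mul_zero, add_zero]
    split_ifs <;> simp <;> ring
  simp only [polyHessian, Matrix.of_apply, map_sum, h, Finset.sum_add_distrib]
  rw [Finset.sum_comm]
  simp only [Finset.sum_ite_eq', Finset.mem_univ, if_true, ← Finset.sum_add_distrib]
  exact Finset.sum_congr rfl fun j _ => by push_cast; ring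

theorem sum_eval_pderiv_polyHessian {n : ℕ} (A : Fin n → Fin n → Fin n → Fin n → ℤ)
    (x y : Fin n → ℚ) (m : Fin n) :
    ∑ k, ∑ l, MvPolynomial.eval x (MvPolynomial.pderiv m (polyHessian A k l)) * y k * y l =
      2 * ∑ j, ∑ k, ∑ l, ((A m j k l + A j m k l : ℤ) : ℚ) * x j * y k * y l := by
  have swap : ∀ f : Fin n → Fin n → Fin n → ℚ,
      ∑ j, ∑ k, ∑ l, f j k l = ∑ k, ∑ l, ∑ j, f j k l := fun f => by
    rw [Finset.sum_comm]
    exact Finset.sum_congr rfl fun k _ => Finset.sum_comm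
  rw [swap, two_mul]
  nth_rewrite 3 [Finset.sum_comm]
  simp only [← Finset.sum_add_distrib]
  refine Finset.sum_congr rfl fun k _ => Finset.sum_congr rfl fun l _ => ?_
  rw [eval_pderiv_polyHessian, Finset.sum_mul, Finset.sum_mul]
  exact Finset.sum_congr rfl fun j _ => by push_cast; ring

/-- for a smooth biquadratic hypersurface, `det(F_x)` is not identically
zero. -/
theorem detFx_not_identically_zero (n : ℕ) (hn : 2 ≤ n)
    (A : Fin n → Fin n → Fin n → Fin n → ℤ) (hA : SmoothBiquad A) :
    ∃ x : Fin n → ℚ, (matFx A x).det ≠ 0 := by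
  by_contra! hdet
  have hpoly : (polyHessian A).det = 0 := MvPolynomial.funext fun x => by
    rw [RingHom.map_det, RingHom.mapMatrix_apply, map_eval_polyHessian, Matrix.det_smul, hdet,
      mul_zero, map_zero]
  obtain ⟨v, hv0, hv⟩ := Matrix.exists_mulVec_eq_zero_iff.mpr hpoly
  replace hv : ∀ k, ∑ l, polyHessian A k l * v l = 0 := fun k => congrFun hv k
  obtain ⟨k₀, hk₀⟩ := Function.ne_iff.mp hv0
  let i₀ : Fin n := ⟨0, by omega⟩
  obtain ⟨x, hx⟩ : ∃ x, MvPolynomial.eval x (MvPolynomial.X i₀ * v k₀) ≠ 0 := by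
    by_contra! h
    exact mul_ne_zero (MvPolynomial.X_ne_zero i₀) hk₀ (MvPolynomial.funext (by simpa using h))
  rw [map_mul, MvPolynomial.eval_X, mul_ne_zero_iff] at hx
  let y : Fin n → ℚ := fun k => MvPolynomial.eval x (v k)
  have hX : ∀ m, ∑ j, ∑ k, ∑ l, ((A m j k l + A j m k l : ℤ) : ℚ) * x j * y k * y l = 0 := by
    intro m
    have h := congrArg (MvPolynomial.eval x) (sum_mul_derivation_mul_eq_zero
      (MvPolynomial.pderiv m) (polyHessian A) (polyHessian_symm A) v hv)
    simp only [map_sum, map_mul, map_zero] at h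
    exact (mul_eq_zero.mp ((sum_eval_pderiv_polyHessian A x y m).symm.trans h)).resolve_left
      two_ne_zero
  have hY : ∀ m, ∑ i, ∑ j, ∑ l, ((A i j m l + A i j l m : ℤ) : ℚ) * x i * x j * y l = 0 := by
    intro m
    have h := congrArg (MvPolynomial.eval x) (hv m)
    simp only [map_sum, map_mul, map_zero, eval_polyHessian, Finset.sum_mul] at h
    rw [← h]
    exact ((Finset.sum_congr rfl fun i _ => Finset.sum_comm).trans Finset.sum_comm)
  refine hA (fun i => (x i : ℂ)) (fun k => (y k : ℂ)) (fun h => hx.1 ?_) (fun h => hx.2 ?_)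
    ⟨fun m => ?_, fun m => ?_⟩
  · exact Rat.cast_eq_zero.mp (congrFun h i₀)
  · exact Rat.cast_eq_zero.mp (congrFun h k₀)
  · exact_mod_cast congrArg (Rat.cast : ℚ → ℂ) (hX m)
  · exact_mod_cast congrArg (Rat.cast : ℚ → ℂ) (hY m)

end
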